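/- Let B be a one-dimensional fractional Brownian motion with Hurst parameter H ∈ (0, 1/2). Then the sum of squared increments Σ_{k=0}^{n-1} |B_{(k+1)/n} - B_{k/n}|² converges to +∞ almost surely as n → ∞. -/

import Mathlib

open MeasureTheory ProbabilityTheory Filter

/-- The Laplace transform of the square of a centered Gaussian variable, in the range where it is
controlled by the exponential of half its first-order term. -/
lemma integral_exp_neg_mul_sq_gaussianReal_le {a : ℝ} (ha : 0 ≤ a) (v : NNReal)
    (hav : 2 * a * v ≤ 1) :
    ∫ x, Real.exp (-(a * x ^ 2)) ∂(gaussianReal 0 v) ≤ Real.exp (-(a * v / 2)) := by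
  rcases eq_or_ne v 0 with rfl | hv
  · simp
  have hv' : (0 : ℝ) < v := by positivity
  have key : ∫ x, Real.exp (-(a * x ^ 2)) ∂(gaussianReal 0 v) = (√(1 + 2 * a * v))⁻¹ := by
    have h1 : ∀ x : ℝ, gaussianPDFReal 0 v x • Real.exp (-(a * x ^ 2))
        = (√(2 * Real.pi * v))⁻¹ * Real.exp (-(a + (2 * (v : ℝ))⁻¹) * x ^ 2) := by
      intro x
      rw [gaussianPDFReal, smul_eq_mul, mul_assoc, ← Real.exp_add]
      congr 2
      field_simp
      ring
    rw [integral_gaussianReal_eq_integral_smul hv]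
    simp_rw [h1]
    rw [integral_const_mul, integral_gaussian, ← Real.sqrt_inv, ← Real.sqrt_inv,
      ← Real.sqrt_mul (by positivity)]
    congr 1
    field_simp
    ring
  rw [key, Real.exp_neg]
  have h2 : Real.exp (a * v) ≤ 1 + 2 * a * v := by
    have h0 : 0 ≤ a * v := by positivity
    have := Real.exp_bound_div_one_sub_of_interval h0 (by linarith)
    refine this.trans ?_
    rw [div_le_iff₀ (by linarith)]
    nlinarith
  gcongr
  apply Real.le_sqrt_of_sq_le
  rw [← Real.exp_nat_mul]
  convert h2 using 2
  push_cast
  ring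

lemma abs_add_rpow_add_abs_sub_rpow_le {p x h : ℝ} (hp0 : 0 ≤ p) (hp1 : p ≤ 1) (hh : 0 ≤ h)
    (hx : h ≤ |x|) : |x + h| ^ p + |x - h| ^ p ≤ 2 * |x| ^ p := by
  wlog hx0 : 0 ≤ x generalizing x
  · have := this (x := -x) (by simpa using hx) (by linarith)
    rw [abs_neg, show -x + h = -(x - h) by ring, show -x - h = -(x + h) by ring, abs_neg,
      abs_neg] at this
    linarith
  rw [abs_of_nonneg hx0] at hx ⊢
  rw [abs_of_nonneg (by linarith), abs_of_nonneg (by linarith)]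
  have := (Real.concaveOn_rpow hp0 hp1).2 (Set.mem_Ici.2 (by linarith : 0 ≤ x + h))
    (Set.mem_Ici.2 (by linarith : 0 ≤ x - h)) (by norm_num : (0 : ℝ) ≤ 1 / 2)
    (by norm_num : (0 : ℝ) ≤ 1 / 2) (by norm_num)
  simp only [smul_eq_mul] at this
  rw [show 1 / 2 * (x + h) + 1 / 2 * (x - h) = x by ring] at this
  linarith

namespace Matrix.IsHermitian

/-- The eigenvalues of a symmetric real matrix are bounded by its largest absolute row sum. -/
lemma eigenvalues_le_of_sum_abs_le {ι : Type*} [Fintype ι] [DecidableEq ι] {K : Matrix ι ι ℝ}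
    (hK : K.IsHermitian) {L : ℝ} (hL : ∀ i, ∑ j, |K i j| ≤ L) (i : ι) : hK.eigenvalues i ≤ L := by
  have hv : Module.End.HasEigenvalue (Matrix.toLin' K) (hK.eigenvalues i) := by
    refine Module.End.hasEigenvalue_of_hasEigenvector
      (x := (hK.eigenvectorBasis i).ofLp) ⟨?_, ?_⟩
    · rw [Module.End.mem_eigenspace_iff, Matrix.toLin'_apply]
      exact hK.mulVec_eigenvectorBasis i
    · intro h
      exact hK.eigenvectorBasis.orthonormal.ne_zero i (by ext j; exact congrFun h j)
  obtain ⟨k, hk⟩ := eigenvalue_mem_ball hv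
  rw [Metric.mem_closedBall, Real.dist_eq] at hk
  have h1 := hL k
  rw [← Finset.add_sum_erase _ _ (Finset.mem_univ k)] at h1
  simp only [Real.norm_eq_abs] at hk
  linarith [le_abs_self (hK.eigenvalues i - K k k), le_abs_self (K k k)]

end Matrix.IsHermitian

section CenteredGaussian

variable {Ω ι : Type*} [MeasurableSpace Ω] {μ : Measure Ω} [Fintype ι]

lemma memLp_two_of_map_eq_gaussianReal {Y : Ω → ℝ} (hY : Measurable Y) {v : NNReal}
    (h : μ.map Y = gaussianReal 0 v) : MemLp Y 2 μ := by
  have h2 : MemLp id 2 (μ.map Y) := by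
    rw [h]; exact memLp_id_gaussianReal 2
  exact h2.comp_of_map hY.aemeasurable

lemma integral_of_map_eq_gaussianReal {Y : Ω → ℝ} (hY : Measurable Y) {v : NNReal}
    (h : μ.map Y = gaussianReal 0 v) : ∫ ω, Y ω ∂μ = 0 := by
  have := integral_map (μ := μ) hY.aemeasurable (f := fun x : ℝ => x) (by fun_prop)
  rw [← this, h, integral_id_gaussianReal]

lemma integral_sq_of_map_eq_gaussianReal {Y : Ω → ℝ} (hY : Measurable Y) {v : NNReal}
    (h : μ.map Y = gaussianReal 0 v) : ∫ ω, Y ω * Y ω ∂μ = v := by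
  have := integral_map (μ := μ) hY.aemeasurable (f := fun x : ℝ => x * x) (by fun_prop)
  rw [← this, h, ← variance_fun_id_gaussianReal (μ := 0) (v := v),
    variance_of_integral_eq_zero (by fun_prop) integral_id_gaussianReal]
  simp [sq]

/-- The family `X` is a centered Gaussian vector: all its linear combinations are centered
Gaussian. -/
def IsCenteredGaussianVector (X : ι → Ω → ℝ) (μ : Measure Ω) : Prop :=
  ∀ c : ι → ℝ, ∃ v : NNReal, μ.map (fun ω => ∑ i, c i * X i ω) = gaussianReal 0 v

lemma IsCenteredGaussianVector.exists_map_eq [DecidableEq ι] {X : ι → Ω → ℝ}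
    (hX : IsCenteredGaussianVector X μ) (i : ι) : ∃ v : NNReal, μ.map (X i) = gaussianReal 0 v := by
  simpa [Finset.sum_ite_eq', Pi.single_apply] using hX (Pi.single i 1)

lemma IsCenteredGaussianVector.hasGaussianLaw {X : ι → Ω → ℝ}
    (hX : IsCenteredGaussianVector X μ) (hm : ∀ i, Measurable (X i)) :
    HasGaussianLaw (fun ω i => X i ω) μ := by
  classical
  refine ⟨isGaussian_of_map_eq_gaussianReal fun L => ?_⟩
  obtain ⟨v, hv⟩ := hX fun i => L (Pi.single i 1)
  refine ⟨0, v, ?_⟩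
  rw [Measure.map_map (by fun_prop) (by fun_prop), ← hv]
  congr 1
  ext ω
  simp only [Function.comp_apply]
  conv_lhs => rw [← Finset.univ_sum_single (fun i => X i ω), map_sum]
  refine Finset.sum_congr rfl fun i _ => ?_
  rw [mul_comm, ← smul_eq_mul, ← map_smul, ← Pi.single_smul, smul_eq_mul, mul_one]

lemma IsCenteredGaussianVector.linear_comb {κ : Type*} [Fintype κ] {X : ι → Ω → ℝ}
    (hX : IsCenteredGaussianVector X μ) (u : κ → ι → ℝ) :
    IsCenteredGaussianVector (fun k ω => ∑ i, u k i * X i ω) μ := by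
  intro c
  obtain ⟨v, hv⟩ := hX fun i => ∑ k, c k * u k i
  refine ⟨v, ?_⟩
  rw [← hv]
  congr 1
  ext ω
  simp_rw [Finset.mul_sum, Finset.sum_mul, mul_assoc]
  exact Finset.sum_comm

/-- Laplace bound for the squared norm of a Gaussian vector whose coordinates are uncorrelated. -/
lemma IsCenteredGaussianVector.integral_exp_neg_le_of_uncorrelated {X : ι → Ω → ℝ}
    (hX : IsCenteredGaussianVector X μ) (hm : ∀ i, Measurable (X i))
    (h : ∀ i j, i ≠ j → ∫ ω, X i ω * X j ω ∂μ = 0) {a : ℝ} (ha : 0 ≤ a)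
    (haX : ∀ i, 2 * a * ∫ ω, X i ω * X i ω ∂μ ≤ 1) :
    ∫ ω, Real.exp (-(a * ∑ i, X i ω ^ 2)) ∂μ
      ≤ Real.exp (-(a * (∑ i, ∫ ω, X i ω * X i ω ∂μ) / 2)) := by
  classical
  choose v hv using hX.exists_map_eq
  have hG := hX.hasGaussianLaw hm
  have := hG.isProbabilityMeasure
  have hind : iIndepFun X μ := by
    refine hG.iIndepFun_of_covariance_eq_zero fun i j hij => ?_
    rw [covariance_eq_sub (memLp_two_of_map_eq_gaussianReal (hm i) (hv i))
      (memLp_two_of_map_eq_gaussianReal (hm j) (hv j)),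
      integral_of_map_eq_gaussianReal (hm i) (hv i)]
    simpa using h i j hij
  simp_rw [fun i => integral_sq_of_map_eq_gaussianReal (hm i) (hv i)] at haX ⊢
  calc ∫ ω, Real.exp (-(a * ∑ i, X i ω ^ 2)) ∂μ
      = ∫ ω, ∏ i, Real.exp (-(a * X i ω ^ 2)) ∂μ := by
        simp_rw [← Real.exp_sum, Finset.sum_neg_distrib, Finset.mul_sum]
    _ = ∏ i, ∫ ω, Real.exp (-(a * X i ω ^ 2)) ∂μ :=
        hind.integral_fun_prod_comp (f := fun _ x => Real.exp (-(a * x ^ 2)))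
          (fun i => (hm i).aemeasurable) (fun i => by fun_prop)
    _ ≤ ∏ i, Real.exp (-(a * v i / 2)) := by
        refine Finset.prod_le_prod (fun i _ => integral_nonneg fun _ => (Real.exp_pos _).le)
          fun i _ => ?_
        rw [← integral_map (μ := μ) (hm i).aemeasurable
          (f := fun x : ℝ => Real.exp (-(a * x ^ 2))) (by fun_prop), hv i]
        exact integral_exp_neg_mul_sq_gaussianReal_le ha _ (haX i)
    _ = _ := by
        rw [← Real.exp_sum, Finset.sum_neg_distrib, Finset.mul_sum, Finset.sum_div]

/-- Laplace bound for the squared norm of a Gaussian vector, in terms of the absolute row sums of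
its covariance matrix. -/
lemma IsCenteredGaussianVector.integral_exp_neg_le {X : ι → Ω → ℝ}
    (hX : IsCenteredGaussianVector X μ) (hm : ∀ i, Measurable (X i))
    {a L : ℝ} (ha : 0 ≤ a) (haL : 2 * a * L ≤ 1)
    (hL : ∀ i, ∑ j, |∫ ω, X i ω * X j ω ∂μ| ≤ L) :
    ∫ ω, Real.exp (-(a * ∑ i, X i ω ^ 2)) ∂μ
      ≤ Real.exp (-(a * (∑ i, ∫ ω, X i ω * X i ω ∂μ) / 2)) := by
  classical
  let K : Matrix ι ι ℝ := Matrix.of fun i j => ∫ ω, X i ω * X j ω ∂μ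
  have hK : K.IsHermitian := by
    ext i j
    simp [K, mul_comm]
  let u : ι → ι → ℝ := fun k => (hK.eigenvectorBasis k).ofLp
  let Y : ι → Ω → ℝ := fun k ω => ∑ i, u k i * X i ω
  have hYm : ∀ k, Measurable (Y k) := fun k => by fun_prop
  have hmem : ∀ i, MemLp (X i) 2 μ := fun i =>
    memLp_two_of_map_eq_gaussianReal (hm i) (hX.exists_map_eq i).choose_spec
  have hcov : ∀ k l, ∫ ω, Y k ω * Y l ω ∂μ = if k = l then hK.eigenvalues l else 0 := by
    intro k l
    have h1 : ∫ ω, Y k ω * Y l ω ∂μ = ∑ i, ∑ j, u k i * (K i j * u l j) := by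
      simp only [Y, Finset.sum_mul_sum]
      have hint : ∀ i j, Integrable (fun ω => u k i * X i ω * (u l j * X j ω)) μ := fun i j =>
        ((hmem i).const_mul _).integrable_mul ((hmem j).const_mul _)
      rw [integral_finsetSum _ fun i _ => integrable_finsetSum _ fun j _ => hint i j]
      refine Finset.sum_congr rfl fun i _ => ?_
      rw [integral_finsetSum _ fun j _ => hint i j]
      refine Finset.sum_congr rfl fun j _ => ?_
      simp only [K, Matrix.of_apply]
      rw [← integral_mul_const, ← integral_const_mul]
      congr 1
      ext ω
      ring
    have h2 : ∀ i, ∑ j, K i j * u l j = hK.eigenvalues l * u l i := fun i =>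
      congrFun (hK.mulVec_eigenvectorBasis l) i
    have h3 : ∑ i, u k i * u l i = if k = l then 1 else 0 := by
      rw [← orthonormal_iff_ite.mp hK.eigenvectorBasis.orthonormal k l, PiLp.inner_apply]
      simp [u, mul_comm]
    rw [h1]
    simp_rw [← Finset.mul_sum, h2, mul_left_comm (u k _) (hK.eigenvalues l)]
    rw [← Finset.mul_sum, h3]
    simp
  have hsq : ∀ ω, ∑ k, Y k ω ^ 2 = ∑ i, X i ω ^ 2 := by
    intro ω
    have := hK.eigenvectorBasis.sum_sq_inner_right (WithLp.toLp 2 fun i => X i ω)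
    rw [EuclideanSpace.real_norm_sq_eq] at this
    rw [← this]
    refine Finset.sum_congr rfl fun k _ => ?_
    simp [Y, u, PiLp.inner_apply, mul_comm]
  have htr : ∑ i, ∫ ω, X i ω * X i ω ∂μ = ∑ k, ∫ ω, Y k ω * Y k ω ∂μ := by
    simp_rw [hcov]
    simpa [Matrix.trace, K] using hK.trace_eq_sum_eigenvalues
  simp_rw [htr, ← hsq]
  refine (hX.linear_comb u).integral_exp_neg_le_of_uncorrelated hYm
    (fun k l hkl => (hcov k l).trans (if_neg hkl)) ha fun k => ?_
  have := hK.eigenvalues_le_of_sum_abs_le hL k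
  rw [hcov, if_pos rfl]
  nlinarith

end CenteredGaussian

section Increments

variable {Ω : Type*} [MeasurableSpace Ω] {μ : Measure Ω} {H : ℝ} {B : ℝ → Ω → ℝ}

lemma integral_increment_mul_increment (hL2 : ∀ t, MemLp (B t) 2 μ)
    (hCov : ∀ s t : ℝ, s ∈ Set.Icc (0:ℝ) 1 → t ∈ Set.Icc (0:ℝ) 1 →
      ∫ ω, B s ω * B t ω ∂μ
        = (1/2) * (s ^ (2*H) + t ^ (2*H) - |t - s| ^ (2*H)))
    {s t u v : ℝ} (hs : s ∈ Set.Icc (0:ℝ) 1) (ht : t ∈ Set.Icc (0:ℝ) 1)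
    (hu : u ∈ Set.Icc (0:ℝ) 1) (hv : v ∈ Set.Icc (0:ℝ) 1) :
    ∫ ω, (B t ω - B s ω) * (B v ω - B u ω) ∂μ
      = (1/2) * (|v - s| ^ (2*H) + |u - t| ^ (2*H) - |v - t| ^ (2*H) - |u - s| ^ (2*H)) := by
  have hint : ∀ x y, Integrable (fun ω => B x ω * B y ω) μ := fun x y =>
    (hL2 x).integrable_mul (hL2 y)
  have : ∀ ω, (B t ω - B s ω) * (B v ω - B u ω)
      = (B t ω * B v ω - B t ω * B u ω) - (B s ω * B v ω - B s ω * B u ω) := fun ω => by ring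
  simp_rw [this]
  rw [integral_sub (f := fun ω => B t ω * B v ω - B t ω * B u ω)
      (g := fun ω => B s ω * B v ω - B s ω * B u ω)
      ((hint t v).sub (hint t u)) ((hint s v).sub (hint s u)),
    integral_sub (hint t v) (hint t u), integral_sub (hint s v) (hint s u),
    hCov _ _ ht hv, hCov _ _ ht hu, hCov _ _ hs hv, hCov _ _ hs hu]
  ring

lemma isCenteredGaussianVector_increments
    (hGauss : ∀ (m : ℕ) (t : Fin m → ℝ) (c : Fin m → ℝ),
      ∃ v : NNReal,
        Measure.map (fun ω => ∑ i, c i * B (t i) ω) μ = gaussianReal 0 v)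
    {n : ℕ} (s t : Fin n → ℝ) :
    IsCenteredGaussianVector (fun k ω => B (t k) ω - B (s k) ω) μ := by
  intro c
  obtain ⟨v, hv⟩ := hGauss (n + n) (Fin.append t s) (Fin.append c (-c))
  refine ⟨v, ?_⟩
  rw [← hv]
  congr 1
  ext ω
  rw [Fin.sum_univ_add]
  simp only [Fin.append_left, Fin.append_right, Pi.neg_apply, neg_mul, mul_sub,
    Finset.sum_sub_distrib, Finset.sum_neg_distrib, ← sub_eq_add_neg]

/-- Lower deviation bound for the quadratic variation along the uniform partition. -/
lemma measureReal_sum_sq_increments_le [IsProbabilityMeasure μ]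
    (hH : H ∈ Set.Ioo (0 : ℝ) (1/2)) (hMeas : ∀ t, Measurable (B t))
    (hGauss : ∀ (m : ℕ) (t : Fin m → ℝ) (c : Fin m → ℝ),
      ∃ v : NNReal,
        Measure.map (fun ω => ∑ i, c i * B (t i) ω) μ = gaussianReal 0 v)
    (hCov : ∀ s t : ℝ, s ∈ Set.Icc (0:ℝ) 1 → t ∈ Set.Icc (0:ℝ) 1 →
      ∫ ω, B s ω * B t ω ∂μ
        = (1/2) * (s ^ (2*H) + t ^ (2*H) - |t - s| ^ (2*H))) {n : ℕ} (hn : 0 < n) :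
    μ.real {ω | ∑ k ∈ Finset.range n, (B (((k : ℝ) + 1) / n) ω - B ((k : ℝ) / n) ω) ^ 2
        ≤ (n : ℝ) ^ (1 - 2 * H) / 4} ≤ Real.exp (-(n / 16)) := by
  have hH0 : 0 < 2 * H := by linarith [hH.1]
  have hH1 : 2 * H ≤ 1 := by linarith [hH.2]
  have hn0 : (0 : ℝ) < n := by exact_mod_cast hn
  have hL2 : ∀ t, MemLp (B t) 2 μ := fun t => by
    obtain ⟨v, hv⟩ := hGauss 1 (fun _ => t) (fun _ => 1)
    exact memLp_two_of_map_eq_gaussianReal (hMeas t) (by simpa using hv)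
  let X : Fin n → Ω → ℝ := fun k ω => B (((k : ℝ) + 1) / n) ω - B ((k : ℝ) / n) ω
  have hXm : ∀ k, Measurable (X k) := fun k => by fun_prop
  have hXG : IsCenteredGaussianVector X μ :=
    isCenteredGaussianVector_increments hGauss (fun k => (k : ℝ) / n) fun k => ((k : ℝ) + 1) / n
  have hmem : ∀ k : Fin n, (k : ℝ) / n ∈ Set.Icc (0 : ℝ) 1 ∧
      ((k : ℝ) + 1) / n ∈ Set.Icc (0 : ℝ) 1 := fun k => by
    have : (k : ℝ) + 1 ≤ n := by exact_mod_cast k.2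
    refine ⟨⟨by positivity, ?_⟩, by positivity, ?_⟩ <;> rw [div_le_one hn0] <;> linarith
  set h : ℝ := (n : ℝ)⁻¹ with hh
  have hh0 : 0 < h := by positivity
  let G : ℝ → ℝ := fun x => |x| ^ (2 * H)
  have hcov : ∀ i j : Fin n, ∫ ω, X i ω * X j ω ∂μ
      = (1/2) * (G (((j : ℝ) - i) * h + h) + G (((j : ℝ) - i) * h - h)
        - 2 * G (((j : ℝ) - i) * h)) := fun i j => by
    rw [integral_increment_mul_increment hL2 hCov (hmem i).1 (hmem i).2 (hmem j).1 (hmem j).2]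
    simp only [G, div_eq_mul_inv, ← hh]
    ring_nf
  have hdiag : ∀ i, ∫ ω, X i ω * X i ω ∂μ = h ^ (2 * H) := fun i => by
    simp [hcov, G, Real.zero_rpow hH0.ne', abs_of_pos hh0]
    ring
  have hoff : ∀ i j, i ≠ j → ∫ ω, X i ω * X j ω ∂μ ≤ 0 := fun i j hij => by
    have h1 : (1 : ℝ) ≤ |(j : ℝ) - i| := by
      have : (1 : ℤ) ≤ |(j : ℤ) - i| := Int.one_le_abs (by
        rw [sub_ne_zero]; exact_mod_cast fun e : (j : ℕ) = i => hij (Fin.ext e.symm))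
      exact_mod_cast this
    have := abs_add_rpow_add_abs_sub_rpow_le (p := 2 * H) (x := ((j : ℝ) - i) * h) hH0.le hH1
      hh0.le (by rw [abs_mul, abs_of_pos hh0]; nlinarith)
    rw [hcov]
    simp only [G]
    linarith
  have hrow : ∀ i, 0 ≤ ∑ j, ∫ ω, X i ω * X j ω ∂μ := fun i => by
    let g : ℕ → ℝ := fun j => G (((j : ℝ) - i) * h) - G (((j : ℝ) - i) * h - h)
    have h1 : ∀ j : Fin n, ∫ ω, X i ω * X j ω ∂μ = (1/2) * (g (j + 1) - g j) := fun j => by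
      rw [hcov]
      simp only [g]
      push_cast
      ring_nf
    simp_rw [h1]
    rw [← Finset.mul_sum, Fin.sum_univ_eq_sum_range (fun j => g (j + 1) - g j),
      Finset.sum_range_sub]
    have hi : (i : ℝ) + 1 ≤ n := by exact_mod_cast i.2
    have h2 : 0 ≤ g n := by
      simp only [g, G, sub_nonneg]
      refine Real.rpow_le_rpow (abs_nonneg _) ?_ hH0.le
      rw [abs_of_nonneg (by nlinarith), abs_of_nonneg (by nlinarith)]
      linarith
    have h3 : g 0 ≤ 0 := by
      simp only [g, G, sub_nonpos]
      refine Real.rpow_le_rpow (abs_nonneg _) ?_ hH0.le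
      have : 0 ≤ (i : ℝ) * h := by positivity
      rw [abs_of_nonpos (by push_cast; linarith), abs_of_nonpos (by push_cast; linarith)]
      linarith
    linarith
  have habs : ∀ i, ∑ j, |∫ ω, X i ω * X j ω ∂μ| ≤ 2 * h ^ (2 * H) := fun i => by
    have h1 := hrow i
    rw [← Finset.add_sum_erase _ _ (Finset.mem_univ i), hdiag] at h1 ⊢
    rw [Finset.sum_congr rfl fun j hj => abs_of_nonpos (hoff i j (Finset.ne_of_mem_erase hj).symm),
      Finset.sum_neg_distrib, abs_of_nonneg (by positivity)]
    linarith
  have hpow : (n : ℝ) ^ (2 * H) * h ^ (2 * H) = 1 := by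
    rw [← Real.mul_rpow hn0.le hh0.le, mul_inv_cancel₀ hn0.ne', Real.one_rpow]
  have hpow' : (n : ℝ) ^ (2 * H) * (n : ℝ) ^ (1 - 2 * H) = n := by
    rw [← Real.rpow_add hn0]
    simp
  have ha : 0 ≤ (n : ℝ) ^ (2 * H) / 4 := by positivity
  have hLap := hXG.integral_exp_neg_le hXm ha (L := 2 * h ^ (2 * H)) (by linarith) habs
  simp_rw [hdiag] at hLap
  rw [Finset.sum_const, Finset.card_univ, Fintype.card_fin, nsmul_eq_mul] at hLap
  simp_rw [← Fin.sum_univ_eq_sum_range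
    (fun k => (B (((k : ℝ) + 1) / n) _ - B ((k : ℝ) / n) _) ^ 2) n]
  have hint : Integrable (fun ω => Real.exp (-((n : ℝ) ^ (2 * H) / 4) * ∑ k, X k ω ^ 2)) μ := by
    refine Integrable.of_bound (by fun_prop) 1 (ae_of_all _ fun ω => ?_)
    rw [Real.norm_eq_abs, Real.abs_exp, Real.exp_le_one_iff, neg_mul, neg_nonpos]
    positivity
  refine (measure_le_le_exp_mul_mgf _ (neg_nonpos.2 ha) hint).trans ?_
  simp only [mgf, neg_mul]
  refine (mul_le_mul_of_nonneg_left hLap (Real.exp_pos _).le).trans ?_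
  rw [← Real.exp_add, Real.exp_le_exp]
  have e1 : (n : ℝ) ^ (2 * H) / 4 * (n * h ^ (2 * H)) = n / 4 := by
    linear_combination (n : ℝ) / 4 * hpow
  have e2 : (n : ℝ) ^ (2 * H) / 4 * ((n : ℝ) ^ (1 - 2 * H) / 4) = n / 16 := by
    linear_combination hpow' / 16
  linarith

end Increments

theorem stmt6 {Ω : Type*} [MeasurableSpace Ω] (μ : Measure Ω) [IsProbabilityMeasure μ]
    (H : ℝ) (hH : H ∈ Set.Ioo (0 : ℝ) (1/2))
    (B : ℝ → Ω → ℝ) (hMeas : ∀ t, Measurable (B t))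
    (hGauss : ∀ (m : ℕ) (t : Fin m → ℝ) (c : Fin m → ℝ),
      ∃ v : NNReal,
        Measure.map (fun ω => ∑ i, c i * B (t i) ω) μ = gaussianReal 0 v)
    (hCov : ∀ s t : ℝ, s ∈ Set.Icc (0:ℝ) 1 → t ∈ Set.Icc (0:ℝ) 1 →
      ∫ ω, B s ω * B t ω ∂μ
        = (1/2) * (s ^ (2*H) + t ^ (2*H) - |t - s| ^ (2*H))) :
    ∀ᵐ ω ∂μ, Filter.Tendsto
      (fun n : ℕ => ∑ k ∈ Finset.range n,
        (B (((k : ℝ) + 1) / n) ω - B ((k : ℝ) / n) ω) ^ 2)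
      Filter.atTop Filter.atTop := by
  have hbound : ∀ n : ℕ, μ {ω | ∑ k ∈ Finset.range n,
      (B (((k : ℝ) + 1) / n) ω - B ((k : ℝ) / n) ω) ^ 2 ≤ (n : ℝ) ^ (1 - 2 * H) / 4}
      ≤ ENNReal.ofReal (Real.exp (-(n / 16))) := fun n => by
    rcases n.eq_zero_or_pos with rfl | hn
    · simpa using prob_le_one
    · rw [← ofReal_measureReal]
      exact ENNReal.ofReal_le_ofReal
        (measureReal_sum_sq_increments_le hH hMeas hGauss hCov hn)
  have hsum : Summable fun n : ℕ => Real.exp (-((n : ℝ) / 16)) := by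
    have := Real.summable_exp_nat_mul_iff.2 (by norm_num : (-(1 / 16) : ℝ) < 0)
    refine this.congr fun n => ?_
    ring_nf
  have hfin := ne_top_of_le_ne_top hsum.tsum_ofReal_ne_top (ENNReal.tsum_le_tsum hbound)
  filter_upwards [ae_eventually_notMem hfin] with ω hω
  have hlim : Tendsto (fun n : ℕ => (n : ℝ) ^ (1 - 2 * H) / 4) atTop atTop :=
    ((tendsto_rpow_atTop (by linarith [hH.2])).comp tendsto_natCast_atTop_atTop).atTop_div_const
      (by norm_num)
  refine tendsto_atTop_mono' _ ?_ hlim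
  filter_upwards [hω] with n hn
  exact (not_le.1 hn).le
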